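/- For each of the two polynomials P_x(s) = (s² + 1)(s⁴ + 2s³ + 3s² + s + 1) and P_y(s) = s⁶ + 2s⁵ + 4s⁴ + 2s³ + 4s² + 2s + 1, let (d_k)_{k∈ℕ} be the Taylor coefficients at 0 of the rational function P_i(s)/((1 − s)³(s² + s + 1)²). Then in each case d_k/k² → 8/9 as k → ∞; in particular both sequences have quadratic growth and vanishing algebraic entropy lim_{k→∞} (1/k)·log d_k = 0. -/

import Mathlib

open Filter Polynomial

/-- A sequence with vanishing third difference is a quadratic polynomial. -/
theorem eq_quadratic_of_third_difference_eq_zero (f : ℕ → ℝ)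
    (h : ∀ q, f (q + 3) = 3 * f (q + 2) - 3 * f (q + 1) + f q) (q : ℕ) :
    f q = f 0 + (f 1 - f 0) * q + (f 2 - 2 * f 1 + f 0) * (q * (q - 1) / 2) := by
  induction q using Nat.strong_induction_on with
  | _ q ih =>
    match q with
    | 0 => simp
    | 1 => simp
    | 2 => push_cast; ring
    | q + 3 =>
      rw [h, ih (q + 2) (by omega), ih (q + 1) (by omega), ih q (by omega)]
      push_cast
      ring

theorem tendsto_periodic_mul_zero (p : ℕ) (hp : 0 < p) (u : ℕ → ℝ) {g : ℕ → ℝ}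
    (hg : Tendsto g atTop (nhds 0)) :
    Tendsto (fun k => u (k % p) * g k) atTop (nhds 0) := by
  refine bdd_le_mul_tendsto_zero' (∑ i ∈ Finset.range p, |u i|) (Eventually.of_forall fun k => ?_) hg
  exact Finset.single_le_sum (f := fun i => |u i|) (fun _ _ => abs_nonneg _)
    (Finset.mem_range.2 (Nat.mod_lt k hp))

/-- A sequence which is quadratic along each residue class modulo `p`, with the same second
difference `c` on every class, grows like `c / (2 * p ^ 2) * k ^ 2`. -/
theorem tendsto_div_sq_of_third_difference_eq_zero (p : ℕ) (hp : 0 < p) (c : ℝ) (d : ℕ → ℝ)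
    (h : ∀ n, d (n + 3 * p) = 3 * d (n + 2 * p) - 3 * d (n + p) + d n)
    (hc : ∀ r < p, d (r + 2 * p) - 2 * d (r + p) + d r = c) :
    Tendsto (fun k : ℕ => d k / (k : ℝ) ^ 2) atTop (nhds (c / (2 * p ^ 2))) := by
  have hp' : (p : ℝ) ≠ 0 := by positivity
  have key (k : ℕ) : d k = d (k % p) + (d (k % p + p) - d (k % p)) * ((k - (k % p : ℕ)) / p)
      + c * ((k - (k % p : ℕ)) / p * ((k - (k % p : ℕ)) / p - 1) / 2) := by
    have hq := eq_quadratic_of_third_difference_eq_zero (fun q => d (k % p + q * p))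
      (fun q => by
        have := h (k % p + q * p)
        convert this using 2 <;> ring_nf) (k / p)
    have hk : k % p + k / p * p = k := Nat.mod_add_div' k p
    have hdiv : ((k / p : ℕ) : ℝ) = (k - (k % p : ℕ)) / p := by
      rw [eq_div_iff hp', eq_sub_iff_add_eq']
      exact_mod_cast hk
    simp only [hk, zero_mul, add_zero, one_mul, hc _ (Nat.mod_lt k hp), hdiv] at hq
    exact hq
  have h1 : Tendsto (fun k : ℕ => 1 / (k : ℝ)) atTop (nhds 0) := tendsto_one_div_atTop_nhds_zero_nat
  have h2 : Tendsto (fun k : ℕ => 1 / (k : ℝ) * (1 / (k : ℝ))) atTop (nhds 0) := by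
    simpa using h1.mul h1
  have hlin := tendsto_periodic_mul_zero p hp
    (fun r => (d (r + p) - d r) / p - c * r / p ^ 2 - c / (2 * p)) h1
  have hconst := tendsto_periodic_mul_zero p hp
    (fun r => d r - (d (r + p) - d r) * r / p + c * r ^ 2 / (2 * p ^ 2) + c * r / (2 * p)) h2
  have hsum := (hlin.add hconst).const_add (c / (2 * (p : ℝ) ^ 2))
  rw [add_zero, add_zero] at hsum
  refine hsum.congr' ?_
  filter_upwards [eventually_gt_atTop 0] with k hk
  have hk' : (k : ℝ) ≠ 0 := by positivity
  rw [key k]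
  field_simp
  ring

theorem tendsto_log_div_of_tendsto_div_sq {d : ℕ → ℝ} {c : ℝ} (hc : 0 < c)
    (h : Tendsto (fun k : ℕ => d k / (k : ℝ) ^ 2) atTop (nhds c)) :
    Tendsto (fun k : ℕ => Real.log (d k) / (k : ℝ)) atTop (nhds 0) := by
  have hlog : Tendsto (fun k : ℕ => Real.log k / (k : ℝ)) atTop (nhds 0) := by
    have := (Real.tendsto_pow_log_div_mul_add_atTop 1 0 1 one_ne_zero).comp
      (tendsto_natCast_atTop_atTop (R := ℝ))
    simpa [Function.comp_def] using this
  have hbdd := (h.log hc.ne').mul tendsto_one_div_atTop_nhds_zero_nat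
  have hsum := hbdd.add (hlog.const_mul 2)
  rw [mul_zero, mul_zero, add_zero] at hsum
  refine hsum.congr' ?_
  filter_upwards [eventually_gt_atTop 0, h.eventually (lt_mem_nhds hc)] with k hk hd
  have hk' : (0 : ℝ) < k := by exact_mod_cast hk
  have hd' : d k ≠ 0 := fun h0 => by simp [h0] at hd
  rw [Real.log_div hd' (by positivity), Real.log_pow]
  push_cast
  ring

/-- Quadratic asymptotics of the Taylor coefficients of `N / (1 - X ^ p) ^ 3`. -/
theorem tendsto_coeff_div_sq (p : ℕ) (hp : 0 < p) (c : ℝ) (d : ℕ → ℝ) (N : ℝ[X])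
    (hN : N.natDegree < 3 * p)
    (hc : ∀ r < p, N.coeff r + N.coeff (r + p) + N.coeff (r + 2 * p) = c)
    (h : (1 - PowerSeries.X ^ p) ^ 3 * PowerSeries.mk d = (N : PowerSeries ℝ)) :
    Tendsto (fun k : ℕ => d k / (k : ℝ) ^ 2) atTop (nhds (c / (2 * p ^ 2))) := by
  have hexp : PowerSeries.mk d - (3 : ℝ) • (PowerSeries.X ^ p * PowerSeries.mk d)
      + (3 : ℝ) • (PowerSeries.X ^ (2 * p) * PowerSeries.mk d)
      - PowerSeries.X ^ (3 * p) * PowerSeries.mk d = (N : PowerSeries ℝ) := by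
    rw [← h]
    simp only [PowerSeries.smul_eq_C_mul, map_ofNat]
    ring
  have hcoeff (n : ℕ) : d n - 3 * (if p ≤ n then d (n - p) else 0)
      + 3 * (if 2 * p ≤ n then d (n - 2 * p) else 0)
      - (if 3 * p ≤ n then d (n - 3 * p) else 0) = N.coeff n := by
    have := congrArg (PowerSeries.coeff n) hexp
    simpa [PowerSeries.coeff_X_pow_mul'] using this
  refine tendsto_div_sq_of_third_difference_eq_zero p hp c d (fun n => ?_) fun r hr => ?_
  · have := hcoeff (n + 3 * p)
    rw [if_pos (by omega), if_pos (by omega), if_pos (by omega),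
      coeff_eq_zero_of_natDegree_lt (by omega), show n + 3 * p - p = n + 2 * p by omega,
      show n + 3 * p - 2 * p = n + p by omega, Nat.add_sub_cancel] at this
    linarith
  · have e0 := hcoeff r
    have e1 := hcoeff (r + p)
    have e2 := hcoeff (r + 2 * p)
    rw [if_neg (by omega), if_neg (by omega), if_neg (by omega)] at e0
    rw [if_pos (by omega), if_neg (by omega), if_neg (by omega), Nat.add_sub_cancel] at e1
    rw [if_pos (by omega), if_pos (by omega), if_neg (by omega), Nat.add_sub_cancel,
      show r + 2 * p - p = r + p by omega] at e2
    linarith [hc r hr]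

/-- Growth for the denominator `(1 - X) ^ 3 * (X ^ 2 + X + 1) ^ 2`, where the numerator
multiplied by `X ^ 2 + X + 1` is `N`. -/
theorem boussinesq_growth (d : ℕ → ℝ) (P N : ℝ[X])
    (h : (((1 - X) ^ 3 * (X ^ 2 + X + 1) ^ 2 : ℝ[X]) : PowerSeries ℝ) * PowerSeries.mk d =
      (P : PowerSeries ℝ))
    (hPN : (X ^ 2 + X + 1) * P = N) (hN : N.natDegree < 9)
    (hc : ∀ r < 3, N.coeff r + N.coeff (r + 3) + N.coeff (r + 6) = 16) :
    Tendsto (fun k : ℕ => d k / (k : ℝ) ^ 2) atTop (nhds (8 / 9)) ∧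
      Tendsto (fun k : ℕ => Real.log (d k) / (k : ℝ)) atTop (nhds 0) := by
  have hmul : (1 - PowerSeries.X ^ 3) ^ 3 * PowerSeries.mk d = (N : PowerSeries ℝ) := by
    rw [← hPN, Polynomial.coe_mul, ← h, ← mul_assoc, ← Polynomial.coe_mul,
      show ((X ^ 2 + X + 1) * ((1 - X) ^ 3 * (X ^ 2 + X + 1) ^ 2) : ℝ[X]) = (1 - X ^ 3) ^ 3 by ring]
    simp
  have hlim := tendsto_coeff_div_sq 3 (by norm_num) 16 d N hN hc hmul
  norm_num at hlim
  exact ⟨hlim, tendsto_log_div_of_tendsto_div_sq (by norm_num) hlim⟩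

/-- The Taylor coefficients of `P_i(s)/((1-s)³(s²+s+1)²)` for the two numerators
`P_x, P_y` of the modified Boussinesq system both satisfy `d_k/k² → 8/9`:
quadratic growth and vanishing algebraic entropy `lim (1/k) log d_k = 0`. -/
theorem modifiedBoussinesq_quadratic_growth
    (dx dy : ℕ → ℝ)
    (hx : (((1 - X) ^ 3 * (X ^ 2 + X + 1) ^ 2 : Polynomial ℝ) : PowerSeries ℝ) *
        PowerSeries.mk dx =
      (((X ^ 2 + 1) * (X ^ 4 + 2 * X ^ 3 + 3 * X ^ 2 + X + 1) :
        Polynomial ℝ) : PowerSeries ℝ))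
    (hy : (((1 - X) ^ 3 * (X ^ 2 + X + 1) ^ 2 : Polynomial ℝ) : PowerSeries ℝ) *
        PowerSeries.mk dy =
      ((X ^ 6 + 2 * X ^ 5 + 4 * X ^ 4 + 2 * X ^ 3 + 4 * X ^ 2 + 2 * X + 1 :
        Polynomial ℝ) : PowerSeries ℝ)) :
    (Tendsto (fun k : ℕ => dx k / (k : ℝ) ^ 2) atTop (nhds (8 / 9)) ∧
      Tendsto (fun k : ℕ => Real.log (dx k) / (k : ℝ)) atTop (nhds 0)) ∧
    (Tendsto (fun k : ℕ => dy k / (k : ℝ) ^ 2) atTop (nhds (8 / 9)) ∧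
      Tendsto (fun k : ℕ => Real.log (dy k) / (k : ℝ)) atTop (nhds 0)) := by
  constructor
  · refine boussinesq_growth dx _
      (C 1 * X ^ 8 + C 3 * X ^ 7 + C 7 * X ^ 6 + C 9 * X ^ 5 + C 11 * X ^ 4 + C 8 * X ^ 3 + C 6 * X ^ 2 + C 2 * X ^ 1 + C 1 * X ^ 0)
      hx ?_ ?_ fun r hr => ?_
    · simp only [map_ofNat, map_one]
      ring
    · refine lt_of_le_of_lt (b := 8) ?_ (by norm_num)
      compute_degree
    · interval_cases r <;> simp [coeff_X, coeff_one] <;> norm_num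
  · refine boussinesq_growth dy _
      (C 1 * X ^ 8 + C 3 * X ^ 7 + C 7 * X ^ 6 + C 8 * X ^ 5 + C 10 * X ^ 4 + C 8 * X ^ 3 + C 7 * X ^ 2 + C 3 * X ^ 1 + C 1 * X ^ 0)
      hy ?_ ?_ fun r hr => ?_
    · simp only [map_ofNat, map_one]
      ring
    · refine lt_of_le_of_lt (b := 8) ?_ (by norm_num)
      compute_degree
    · interval_cases r <;> simp [coeff_X, coeff_one] <;> norm_num
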